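/- Let N be a positive integer, let Ω ⊆ ℝ^N ∖ {0} be an open set, let p, q > 0 and a, b ∈ ℝ, and let (u,v) be a pair of positive C² functions on Ω satisfying −Δu = |x|^a v^p and −Δv = |x|^b u^q on Ω. Assume there exist C² functions ξ > 0, ζ > 0 on Ω such that −Δξ ≥ p |x|^a v(x)^{p−1} ζ and −Δζ ≥ q |x|^b u(x)^{q−1} ξ on Ω. Then for every twice continuously differentiable function φ with compact support contained in Ω: √(pq) ∫_Ω |x|^{(a+b)/2} u(x)^{(q−1)/2} v(x)^{(p−1)/2} φ(x)² dx ≤ ∫_Ω |∇φ(x)|² dx. -/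

import Mathlib

open MeasureTheory Metric Set

noncomputable section

/-- Euclidean space `ℝ^N`. -/
abbrev Euc (N : ℕ) := EuclideanSpace ℝ (Fin N)

/-- The Laplacian of a function `f : ℝ^N → ℝ`, as the sum of the pure second
partial derivatives. -/
def lap {N : ℕ} (f : Euc N → ℝ) (x : Euc N) : ℝ :=
  ∑ i : Fin N, iteratedFDeriv ℝ 2 f x ![EuclideanSpace.single i 1, EuclideanSpace.single i 1]

/-- `(u, v)` is a solution of the Hénon–Lane–Emden system
`-Δu = |x|^a |v|^{p-1} v`, `-Δv = |x|^b |u|^{q-1} u` on `ℝ^N \ {0}`: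
`u, v` are `C²` on `ℝ^N \ {0}`, continuous on `ℝ^N`, and satisfy the equations pointwise. -/
def IsHLESol {N : ℕ} (p q a b : ℝ) (u v : Euc N → ℝ) : Prop :=
  ContDiffOn ℝ 2 u {x : Euc N | x ≠ 0} ∧ ContDiffOn ℝ 2 v {x : Euc N | x ≠ 0} ∧
  Continuous u ∧ Continuous v ∧
  (∀ x : Euc N, x ≠ 0 → -lap u x = ‖x‖ ^ a * (|v x| ^ (p - 1) * v x)) ∧
  (∀ x : Euc N, x ≠ 0 → -lap v x = ‖x‖ ^ b * (|u x| ^ (q - 1) * u x))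

/-- Stability of a (positive) solution of the Hénon–Lane–Emden system on an open set `Ω`:
there exist positive `C²` functions `ξ, ζ` on `Ω` with
`-Δξ ≥ p |x|^a v^{p-1} ζ` and `-Δζ ≥ q |x|^b u^{q-1} ξ` on `Ω`. -/
def HLEStableOn {N : ℕ} (p q a b : ℝ) (u v : Euc N → ℝ) (Ω : Set (Euc N)) : Prop :=
  ∃ ξ ζ : Euc N → ℝ, ContDiffOn ℝ 2 ξ Ω ∧ ContDiffOn ℝ 2 ζ Ω ∧
    (∀ x ∈ Ω, 0 < ξ x) ∧ (∀ x ∈ Ω, 0 < ζ x) ∧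
    (∀ x ∈ Ω, p * ‖x‖ ^ a * v x ^ (p - 1) * ζ x ≤ -lap ξ x) ∧
    (∀ x ∈ Ω, q * ‖x‖ ^ b * u x ^ (q - 1) * ξ x ≤ -lap ζ x)

/-- Stability outside a compact set `K`: stability on every open set whose closure is
compact and contained in `ℝ^N \ K`. -/
def HLEStableOutside {N : ℕ} (p q a b : ℝ) (u v : Euc N → ℝ) (K : Set (Euc N)) : Prop :=
  IsCompact K ∧
    ∀ Ω : Set (Euc N), IsOpen Ω → IsCompact (closure Ω) → closure Ω ⊆ Kᶜ →
      HLEStableOn p q a b u v Ω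

/-- `(u, v)` solves the Lane–Emden system `-Δu = |v|^{p-1} v`, `-Δv = |u|^{q-1} u` on `ℝ^N`. -/
def IsLESol {N : ℕ} (p q : ℝ) (u v : Euc N → ℝ) : Prop :=
  (∀ x : Euc N, -lap u x = |v x| ^ (p - 1) * v x) ∧
  (∀ x : Euc N, -lap v x = |u x| ^ (q - 1) * u x)

/-- Stability of a (positive) solution of the Lane–Emden system on an open set `Ω`. -/
def LEStableOn {N : ℕ} (p q : ℝ) (u v : Euc N → ℝ) (Ω : Set (Euc N)) : Prop :=
  ∃ ξ ζ : Euc N → ℝ, ContDiffOn ℝ 2 ξ Ω ∧ ContDiffOn ℝ 2 ζ Ω ∧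
    (∀ x ∈ Ω, 0 < ξ x) ∧ (∀ x ∈ Ω, 0 < ζ x) ∧
    (∀ x ∈ Ω, p * v x ^ (p - 1) * ζ x ≤ -lap ξ x) ∧
    (∀ x ∈ Ω, q * u x ^ (q - 1) * ξ x ≤ -lap ζ x)

/-- A function on `ℝ^N` is polynomially bounded. -/
def PolyBounded {N : ℕ} (w : Euc N → ℝ) : Prop :=
  ∃ K L R : ℝ, 0 < K ∧ 0 < L ∧ ∀ x : Euc N, R ≤ ‖x‖ → |w x| ≤ K * ‖x‖ ^ L

/-- The polynomial `G` from Theorem 1.4 (iii). -/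
def Gpoly (p q x : ℝ) : ℝ :=
  x ^ 4 - (4 * p * q * (q + 1) / (p + 1)) * x ^ 2 +
    (2 * p * q * (q + 1) * (p + q + 2) / (p + 1) ^ 2) * x -
    p * q * (q + 1) ^ 2 / (p + 1) ^ 2

/-- The vector field `φ² ∇w / w`, in coordinate `i`. -/
def logFlux {N : ℕ} (w φ : Euc N → ℝ) (i : Fin N) (x : Euc N) : ℝ :=
  φ x ^ 2 * (fderiv ℝ w x (EuclideanSpace.single i 1) / w x)

lemma hasCompactSupport_logFlux {N : ℕ} {w φ : Euc N → ℝ} (hφc : HasCompactSupport φ)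
    (i : Fin N) : HasCompactSupport (logFlux w φ i) := by
  refine hφc.mono fun x hx => ?_
  rw [Function.mem_support] at hx ⊢
  contrapose! hx
  simp [logFlux, hx]

lemma logFlux_eventuallyEq_zero {N : ℕ} {w φ : Euc N → ℝ} {x : Euc N} (hx : x ∉ tsupport φ)
    (i : Fin N) : logFlux w φ i =ᶠ[nhds x] fun _ => 0 := by
  filter_upwards [notMem_tsupport_iff_eventuallyEq.mp hx] with y hy
  simp [logFlux, hy]

lemma contDiff_logFlux {N : ℕ} {Ω : Set (Euc N)} (hΩ : IsOpen Ω) {w φ : Euc N → ℝ}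
    (hw : ContDiffOn ℝ 2 w Ω) (hpos : ∀ x ∈ Ω, 0 < w x) (hφ : ContDiff ℝ 2 φ)
    (hsupp : tsupport φ ⊆ Ω) (i : Fin N) : ContDiff ℝ 1 (logFlux w φ i) := by
  rw [contDiff_iff_contDiffAt]
  intro x
  by_cases hx : x ∈ Ω
  · have hwx : ContDiffAt ℝ 2 w x := hw.contDiffAt (hΩ.mem_nhds hx)
    have h1 : ContDiffAt ℝ 1 (fderiv ℝ w) x := hwx.fderiv_right (by norm_num)
    exact ((hφ.contDiffAt.of_le (by norm_num)).pow 2).mul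
      ((h1.clm_apply contDiffAt_const).div (hwx.of_le (by norm_num)) (hpos x hx).ne')
  · exact contDiffAt_const.congr_of_eventuallyEq
      (logFlux_eventuallyEq_zero (fun h => hx (hsupp h)) i)

lemma integrable_fderiv_apply {N : ℕ} {F : Euc N → ℝ} (hF : ContDiff ℝ 1 F)
    (hFc : HasCompactSupport F) (e : Euc N) : Integrable fun x => fderiv ℝ F x e :=
  ((hF.continuous_fderiv one_ne_zero).clm_apply continuous_const).integrable_of_hasCompactSupport
    (hFc.fderiv_apply ℝ e)

lemma integral_fderiv_apply_eq_zero {N : ℕ} {F : Euc N → ℝ} (hF : ContDiff ℝ 1 F)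
    (hFc : HasCompactSupport F) (e : Euc N) : ∫ x, fderiv ℝ F x e = 0 := by
  have h := integral_mul_fderiv_eq_neg_fderiv_mul_of_integrable (μ := volume)
    (f := F) (g := fun _ => (1 : ℝ)) (v := e)
    (by simpa using integrable_fderiv_apply hF hFc e) (by simp)
    (by simpa using hF.continuous.integrable_of_hasCompactSupport hFc)
    (fun x _ => hF.differentiable one_ne_zero x) (fun _ _ => differentiableAt_const _)
  simpa using h

lemma norm_gradient_sq {N : ℕ} (φ : Euc N → ℝ) (x : Euc N) :
    ‖gradient φ x‖ ^ 2 = ∑ i : Fin N, fderiv ℝ φ x (EuclideanSpace.single i 1) ^ 2 := by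
  rw [EuclideanSpace.norm_sq_eq]
  refine Finset.sum_congr rfl fun i _ => ?_
  have h : inner ℝ (gradient φ x) (EuclideanSpace.single i 1)
      = fderiv ℝ φ x (EuclideanSpace.single i 1) := by
    simp [gradient]
  rw [← h, EuclideanSpace.inner_single_right]
  simp

/-- Pointwise form of Picone's inequality. -/
lemma sq_mul_neg_lap_div_le {N : ℕ} {w φ : Euc N → ℝ} {x : Euc N}
    (hw : ContDiffAt ℝ 2 w x) (hpos : 0 < w x) (hφ : DifferentiableAt ℝ φ x) :
    φ x ^ 2 * (-lap w x / w x) ≤ ‖gradient φ x‖ ^ 2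
      - ∑ i : Fin N, fderiv ℝ (logFlux w φ i) x (EuclideanSpace.single i 1) := by
  rw [norm_gradient_sq, ← Finset.sum_sub_distrib, lap, ← Finset.sum_neg_distrib,
    Finset.sum_div, Finset.mul_sum]
  refine Finset.sum_le_sum fun i _ => ?_
  set e : Euc N := EuclideanSpace.single i 1
  have hw1 : HasFDerivAt w (fderiv ℝ w x) x := (hw.differentiableAt (by norm_num)).hasFDerivAt
  have hd : ContDiffAt ℝ 1 (fderiv ℝ w) x := hw.fderiv_right (by norm_num)
  have hw2 : HasFDerivAt (fderiv ℝ w) (fderiv ℝ (fderiv ℝ w) x) x :=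
    (hd.differentiableAt one_ne_zero).hasFDerivAt
  have hw3 := hw2.clm_apply (hasFDerivAt_const e x)
  have hF := (hφ.hasFDerivAt.pow 2).mul 
    (hw3.mul ((hasDerivAt_inv hpos.ne').comp_hasFDerivAt x hw1))
  have hF' : fderiv ℝ (logFlux w φ i) x e
      = 2 * φ x * fderiv ℝ φ x e * (fderiv ℝ w x e / w x)
        + φ x ^ 2 * (fderiv ℝ (fderiv ℝ w) x e e / w x - (fderiv ℝ w x e / w x) ^ 2) := by
    have hfun : logFlux w φ i
        = (fun y => φ y ^ 2) * ((fun y => fderiv ℝ w y e) * ((fun t : ℝ => t⁻¹) ∘ w)) := by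
      ext y
      simp [logFlux, div_eq_mul_inv, e]
    rw [hfun, hF.fderiv]
    simp
    field_simp
    ring
  rw [hF', iteratedFDeriv_two_apply]
  simp only [Matrix.cons_val_zero, Matrix.cons_val_one]
  have := sq_nonneg (fderiv ℝ φ x e - φ x * (fderiv ℝ w x e / w x))
  rw [neg_div]
  nlinarith

/-- The arithmetic-geometric mean inequality for two products of power weights. -/
lemma sqrt_mul_weights_le {p q a b r s t y z : ℝ} (hp : 0 < p) (hq : 0 < q) (hr : 0 < r)
    (hs : 0 < s) (ht : 0 < t) (hy : 0 < y) (hz : 0 < z) :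
    2 * (√(p * q) * (r ^ ((a + b) / 2) * s ^ ((q - 1) / 2) * t ^ ((p - 1) / 2)))
      ≤ p * r ^ a * t ^ (p - 1) * z / y + q * r ^ b * s ^ (q - 1) * y / z := by
  have half : ∀ c d : ℝ, 0 < c → (c ^ (d / 2)) ^ 2 = c ^ d := fun c d hc => by
    rw [← Real.rpow_natCast, ← Real.rpow_mul hc.le]; norm_num
  have hsq : (√(p * q) * (r ^ ((a + b) / 2) * s ^ ((q - 1) / 2) * t ^ ((p - 1) / 2))) ^ 2
      = (p * r ^ a * t ^ (p - 1) * z / y) * (q * r ^ b * s ^ (q - 1) * y / z) := by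
    simp only [mul_pow, half _ _ hr, half _ _ hs, half _ _ ht, Real.sq_sqrt (mul_pos hp hq).le,
      Real.rpow_add hr]
    field_simp
  have hA : 0 < p * r ^ a * t ^ (p - 1) * z / y := by positivity
  have hB : 0 < q * r ^ b * s ^ (q - 1) * y / z := by positivity
  refine (pow_le_pow_iff_left₀ (by positivity) (by positivity) two_ne_zero).mp ?_
  rw [mul_pow, hsq]
  nlinarith [sq_nonneg (p * r ^ a * t ^ (p - 1) * z / y - q * r ^ b * s ^ (q - 1) * y / z)]

/-- Lemma 3.4 (for the Hénon–Lane–Emden nonlinearities): the stability inequality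
`√(pq) ∫ |x|^{(a+b)/2} u^{(q-1)/2} v^{(p-1)/2} φ² ≤ ∫ |∇φ|²`. -/
theorem stmt_15 (N : ℕ) (hN : 0 < N) (Ω : Set (Euc N)) (hΩ : IsOpen Ω)
    (hΩ0 : Ω ⊆ {x : Euc N | x ≠ 0}) (p q a b : ℝ) (hp : 0 < p) (hq : 0 < q)
    (u v : Euc N → ℝ)
    (hu : ContDiffOn ℝ 2 u Ω) (hv : ContDiffOn ℝ 2 v Ω)
    (hupos : ∀ x ∈ Ω, 0 < u x) (hvpos : ∀ x ∈ Ω, 0 < v x)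
    (hequ : ∀ x ∈ Ω, -lap u x = ‖x‖ ^ a * v x ^ p)
    (heqv : ∀ x ∈ Ω, -lap v x = ‖x‖ ^ b * u x ^ q)
    (ξ ζ : Euc N → ℝ)
    (hξ : ContDiffOn ℝ 2 ξ Ω) (hζ : ContDiffOn ℝ 2 ζ Ω)
    (hξpos : ∀ x ∈ Ω, 0 < ξ x) (hζpos : ∀ x ∈ Ω, 0 < ζ x)
    (hstab1 : ∀ x ∈ Ω, p * ‖x‖ ^ a * v x ^ (p - 1) * ζ x ≤ -lap ξ x)
    (hstab2 : ∀ x ∈ Ω, q * ‖x‖ ^ b * u x ^ (q - 1) * ξ x ≤ -lap ζ x)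
    (φ : Euc N → ℝ) (hφ : ContDiff ℝ 2 φ) (hφc : HasCompactSupport φ)
    (hsupp : tsupport φ ⊆ Ω) :
    Real.sqrt (p * q) *
        (∫ x in Ω, ‖x‖ ^ ((a + b) / 2) * u x ^ ((q - 1) / 2) * v x ^ ((p - 1) / 2) * φ x ^ 2)
      ≤ ∫ x in Ω, ‖gradient φ x‖ ^ 2 := by
  set D : (Euc N → ℝ) → Euc N → ℝ := fun w x =>
    ∑ i : Fin N, fderiv ℝ (logFlux w φ i) x (EuclideanSpace.single i 1)
  have hD : ∀ w : Euc N → ℝ, ContDiffOn ℝ 2 w Ω → (∀ x ∈ Ω, 0 < w x) →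
      Integrable (D w) ∧ ∫ x, D w x = 0 := fun w hw hpos => by
    have hC := contDiff_logFlux hΩ hw hpos hφ hsupp
    have hc := hasCompactSupport_logFlux (w := w) hφc
    have hI := fun i => integrable_fderiv_apply (hC i) (hc i) (EuclideanSpace.single i 1)
    refine ⟨integrable_finsetSum _ fun i _ => hI i, ?_⟩
    rw [integral_finsetSum _ fun i _ => hI i]
    exact Finset.sum_eq_zero fun i _ => integral_fderiv_apply_eq_zero (hC i) (hc i) _
  have hD0 : ∀ w : Euc N → ℝ, ∀ x, x ∉ Ω → D w x = 0 := fun w x hx =>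
    Finset.sum_eq_zero fun i _ => by
      simp [(logFlux_eventuallyEq_zero (w := w) (fun h => hx (hsupp h)) i).fderiv_eq]
  have hDΩ : ∀ w : Euc N → ℝ, ContDiffOn ℝ 2 w Ω → (∀ x ∈ Ω, 0 < w x) →
      ∫ x in Ω, D w x = 0 := fun w hw hpos => by
    rw [setIntegral_eq_integral_of_forall_compl_eq_zero (hD0 w), (hD w hw hpos).2]
  have hG : Integrable fun x => ‖gradient φ x‖ ^ 2 := by
    simp only [norm_gradient_sq]
    refine integrable_finsetSum _ fun i _ => ?_
    refine Continuous.integrable_of_hasCompactSupport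
      (((hφ.continuous_fderiv two_ne_zero).clm_apply continuous_const).pow 2) ?_
    exact (hφc.fderiv_apply ℝ (EuclideanSpace.single i 1)).comp_left
      (g := fun y : ℝ => y ^ 2) (by simp)
  have hDξ := (hD ξ hξ hξpos).1.integrableOn (s := Ω)
  have hDζ := (hD ζ hζ hζpos).1.integrableOn (s := Ω)
  have hGΩ := hG.integrableOn (s := Ω)
  have hDsum : Integrable (fun x => (1 / 2) * (D ξ x + D ζ x)) (volume.restrict Ω) :=
    (hDξ.add hDζ).const_mul _
  have hpt : ∀ x ∈ Ω, √(p * q) *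
      (‖x‖ ^ ((a + b) / 2) * u x ^ ((q - 1) / 2) * v x ^ ((p - 1) / 2) * φ x ^ 2)
      ≤ ‖gradient φ x‖ ^ 2 - (1 / 2) * (D ξ x + D ζ x) := fun x hx => by
    have hφx : DifferentiableAt ℝ φ x := hφ.differentiable two_ne_zero x
    have h1 := sq_mul_neg_lap_div_le (hξ.contDiffAt (hΩ.mem_nhds hx)) (hξpos x hx) hφx
    have h2 := sq_mul_neg_lap_div_le (hζ.contDiffAt (hΩ.mem_nhds hx)) (hζpos x hx) hφx
    have h3 := sqrt_mul_weights_le (a := a) (b := b) hp hq (norm_pos_iff.mpr (hΩ0 hx))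
      (hupos x hx) (hvpos x hx) (hξpos x hx) (hζpos x hx)
    have h4 := div_le_div_of_nonneg_right (hstab1 x hx) (hξpos x hx).le
    have h5 := div_le_div_of_nonneg_right (hstab2 x hx) (hζpos x hx).le
    have h6 := mul_le_mul_of_nonneg_left (h3.trans (add_le_add h4 h5)) (sq_nonneg (φ x))
    simp only [D]
    linarith
  rw [← integral_const_mul]
  calc _ ≤ ∫ x in Ω, (‖gradient φ x‖ ^ 2 - (1 / 2) * (D ξ x + D ζ x)) := by
        refine integral_mono_of_nonneg ?_ (hGΩ.sub hDsum) ?_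
        · filter_upwards [ae_restrict_mem hΩ.measurableSet] with x hx
          have := hupos x hx
          have := hvpos x hx
          simp only [Pi.zero_apply]
          positivity
        · filter_upwards [ae_restrict_mem hΩ.measurableSet] with x hx using hpt x hx
    _ = ∫ x in Ω, ‖gradient φ x‖ ^ 2 := by
        rw [integral_sub hGΩ hDsum, integral_const_mul,
          integral_add hDξ hDζ, hDΩ ξ hξ hξpos, hDΩ ζ hζ hζpos]
        simp
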